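/- Let μ satisfy Assumption C. Then the conditional expectation given the second coordinate maps L¹ of the first marginal into L^∞: there exists a constant K > 0 (one may take K = C divided by the minimum of q₂ on [a,b]) such that for every f ∈ L¹(μ₁), ‖E₂[f∘pr₁]‖_{L^∞(μ)} ≤ K · ‖f‖_{L¹(μ₁)}. -/

import Mathlib

open MeasureTheory ENNReal Filter

noncomputable section

/-- The σ-algebra on `ℝ × ℝ` generated by the first coordinate projection `pr₁`. -/
def m1 : MeasurableSpace (ℝ × ℝ) := MeasurableSpace.comap Prod.fst inferInstance

/-- The σ-algebra on `ℝ × ℝ` generated by the second coordinate projection `pr₂`. -/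
def m2 : MeasurableSpace (ℝ × ℝ) := MeasurableSpace.comap Prod.snd inferInstance

/-- The first marginal `μ₁` of a measure on `ℝ × ℝ`. -/
def marg1 (μ : Measure (ℝ × ℝ)) : Measure ℝ := μ.map Prod.fst

/-- The second marginal `μ₂` of a measure on `ℝ × ℝ`. -/
def marg2 (μ : Measure (ℝ × ℝ)) : Measure ℝ := μ.map Prod.snd

/-- Assumption C: `μ` is a martingale probability measure on `ℝ²` which disintegrates as
`μ(dx₁,dx₂) = κ(x₁,x₂) dx₂ μ₁(dx₁)` with `c ≤ κ ≤ C`, whose second marginal has a continuous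
strictly positive density on a bounded interval `[a,b]`, and which satisfies the
informational discrepancy property. -/
structure AssumptionC (μ : Measure (ℝ × ℝ)) : Prop where
  /-- `μ` is a probability measure. -/
  prob : IsProbabilityMeasure μ
  /-- (0) `μ` is a martingale measure: `E[X₂ | X₁] = X₁` `μ`-a.e. -/
  martingale :
    (fun x : ℝ × ℝ => x.1) =ᵐ[μ] μ[(fun x : ℝ × ℝ => x.2) | m1]
  /-- (i) disintegration `μ(dx₁,dx₂) = κ(x₁,x₂) dx₂ μ₁(dx₁)` with `0 < c ≤ κ ≤ C` a.e. -/
  disint : ∃ κ : ℝ × ℝ → ℝ, ∃ c C : ℝ, Measurable κ ∧ 0 < c ∧ c ≤ C ∧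
      (∀ᵐ x ∂μ, c ≤ κ x ∧ κ x ≤ C) ∧
      μ = ((marg1 μ).prod volume).withDensity (fun x => ENNReal.ofReal (κ x))
  /-- (ii) `μ₂` has density `q₂ · 𝟙_{[a,b]}` with `q₂` continuous and strictly positive
  on the bounded interval `[a,b]`. -/
  marginal2 : ∃ a b : ℝ, ∃ q₂ : ℝ → ℝ, a ≤ b ∧ ContinuousOn q₂ (Set.Icc a b) ∧
      (∀ t ∈ Set.Icc a b, 0 < q₂ t) ∧
      marg2 μ =
        volume.withDensity (Set.indicator (Set.Icc a b) (fun t => ENNReal.ofReal (q₂ t)))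
  /-- (iii) informational discrepancy: if `f(x₁) = g(x₂)` `μ`-a.e. then both are a.e.
  equal to a common constant. -/
  discrepancy : ∀ f g : ℝ → ℝ, Integrable f (marg1 μ) →
      Integrable g (marg2 μ) → (∀ᵐ x ∂μ, f x.1 = g x.2) →
      ∃ e : ℝ, (f =ᵐ[marg1 μ] fun _ => e) ∧ (g =ᵐ[marg2 μ] fun _ => e)

/-- If the averages of `‖f‖` over `m`-measurable sets are at most `R`, then the conditional
expectation of `f` given `m` is essentially bounded by `R`. -/
theorem eLpNorm_top_condExp_le_of_setIntegral_norm_le {α : Type*} {m m₀ : MeasurableSpace α}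
    {μ : Measure α} [IsFiniteMeasure μ] (hm : m ≤ m₀) {f : α → ℝ} {R : ℝ}
    (h : ∀ s, MeasurableSet[m] s → ∫ x in s, ‖f x‖ ∂μ ≤ R * μ.real s) :
    eLpNorm (μ[f | m]) ∞ μ ≤ ENNReal.ofReal R := by
  have hsm : StronglyMeasurable[m] fun x => ‖(μ[f | m]) x‖ := stronglyMeasurable_condExp.norm
  have hle : (fun x => ‖(μ[f | m]) x‖) ≤ᵐ[μ.trim hm] fun _ => R := by
    refine ae_le_of_forall_setIntegral_le (integrable_condExp.norm.trim hm hsm)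
      (integrable_const R) fun s hs _ => ?_
    rw [← setIntegral_trim hm hsm hs, ← setIntegral_trim hm stronglyMeasurable_const hs]
    refine (setIntegral_norm_condExp_le hs f).trans ((h s hs).trans_eq ?_)
    simp [mul_comm]
  rw [eLpNorm_exponent_top]
  exact eLpNormEssSup_le_of_ae_bound (ae_of_ae_trim hm hle)

/-- A measure whose density with respect to `ν` is almost everywhere at most `C` is at most
`C • ν`, even if the bound is only known almost everywhere for the measure itself. -/
theorem withDensity_ofReal_le_smul {α : Type*} {m₀ : MeasurableSpace α} {ν : Measure α}
    {κ : α → ℝ} {C : ℝ} (hκ : Measurable κ)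
    (h : ∀ᵐ x ∂ν.withDensity fun x => ENNReal.ofReal (κ x), κ x ≤ C) :
    ν.withDensity (fun x => ENNReal.ofReal (κ x)) ≤ ENNReal.ofReal C • ν := by
  rw [← withDensity_const]
  refine withDensity_mono ?_
  filter_upwards [(ae_withDensity_iff hκ.ennreal_ofReal).1 h] with x hx
  by_cases h0 : ENNReal.ofReal (κ x) = 0
  · simp [h0]
  · exact ENNReal.ofReal_le_ofReal (hx h0)

/-- A density bounded below by `δ` on a measurable set `I` controls the reference measure
on `I`. -/
theorem mul_measure_inter_le_withDensity_indicator {α : Type*} {m₀ : MeasurableSpace α}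
    {ν : Measure α} {I E : Set α} {q : α → ℝ≥0∞} {δ : ℝ≥0∞} (hI : MeasurableSet I)
    (hE : MeasurableSet E) (h : ∀ t ∈ I, δ ≤ q t) :
    δ * ν (E ∩ I) ≤ ν.withDensity (I.indicator q) E := by
  rw [withDensity_apply _ hE, setLIntegral_indicator hI, Set.inter_comm E I,
    ← setLIntegral_const]
  exact setLIntegral_mono' (hI.inter hE) fun t ht => h t ht.1

/-- under Assumption C, the conditional expectation given the second
coordinate maps `L¹(μ₁)` into `L^∞(μ)`:
`‖E₂[f ∘ pr₁]‖_{L^∞(μ)} ≤ K ‖f‖_{L¹(μ₁)}`. -/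
theorem condexp_snd_L1_to_Linfty (μ : Measure (ℝ × ℝ)) (hC : AssumptionC μ) :
    ∃ K : ℝ, 0 < K ∧ ∀ f : ℝ → ℝ, Integrable f (marg1 μ) →
      eLpNorm (μ[(fun x : ℝ × ℝ => f x.1) | m2]) ∞ μ ≤
        ENNReal.ofReal K * eLpNorm f 1 (marg1 μ) := by
  have := hC.prob
  obtain ⟨κ, c, C, hκ, hc, hcC, hκC, hdis⟩ := hC.disint
  obtain ⟨a, b, q, hab, hqc, hqpos, hq⟩ := hC.marginal2
  obtain ⟨t₀, ht₀, hmin⟩ := isCompact_Icc.exists_isMinOn (Set.nonempty_Icc.2 hab) hqc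
  have hδ : 0 < q t₀ := hqpos t₀ ht₀
  have hCpos : 0 < C := hc.trans_le hcC
  have : IsProbabilityMeasure (marg1 μ) :=
    Measure.isProbabilityMeasure_map measurable_fst.aemeasurable
  have hμle : μ ≤ ENNReal.ofReal C • (marg1 μ).prod volume := by
    have hub : ∀ᵐ x ∂μ, κ x ≤ C := hκC.mono fun x hx => hx.2
    rw [hdis] at hub
    exact hdis.trans_le (withDensity_ofReal_le_smul hκ hub)
  refine ⟨C / q t₀, div_pos hCpos hδ, fun f hf => ?_⟩
  have hbound (E : Set ℝ) (hE : MeasurableSet E) :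
      ∫⁻ x in Prod.snd ⁻¹' E, ‖f x.1‖ₑ ∂μ ≤
        ENNReal.ofReal (C / q t₀) * (∫⁻ t, ‖f t‖ₑ ∂marg1 μ) * μ (Prod.snd ⁻¹' E) := by
    have hsupp : (Prod.snd ⁻¹' E : Set (ℝ × ℝ)) =ᵐ[μ] Set.univ ×ˢ (E ∩ Set.Icc a b) := by
      have h2 : ∀ᵐ t ∂marg2 μ, t ∈ Set.Icc a b := by
        rw [ae_iff, hq]
        change (volume.withDensity _) (Set.Icc a b)ᶜ = 0
        rw [withDensity_apply _ measurableSet_Icc.compl,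
          setLIntegral_indicator measurableSet_Icc]
        simp
      filter_upwards [ae_of_ae_map measurable_snd.aemeasurable h2] with x hx
      apply propext
      change x.2 ∈ E ↔ x ∈ Set.univ ×ˢ (E ∩ Set.Icc a b)
      simp only [Set.mem_prod, Set.mem_univ, true_and, Set.mem_inter_iff, hx, and_true]
    have hvol : volume (E ∩ Set.Icc a b) ≤
        (ENNReal.ofReal (q t₀))⁻¹ * μ (Prod.snd ⁻¹' E) := by
      rw [mul_comm, ← div_eq_mul_inv,
        ENNReal.le_div_iff_mul_le (by simp [hδ]) (by simp), mul_comm,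
        ← Measure.map_apply measurable_snd hE]
      change _ ≤ marg2 μ E
      rw [hq]
      exact mul_measure_inter_le_withDensity_indicator measurableSet_Icc hE
        fun t ht => ENNReal.ofReal_le_ofReal (hmin ht)
    calc ∫⁻ x in Prod.snd ⁻¹' E, ‖f x.1‖ₑ ∂μ
        = ∫⁻ x in Set.univ ×ˢ (E ∩ Set.Icc a b), ‖f x.1‖ₑ ∂μ := setLIntegral_congr hsupp
      _ ≤ ∫⁻ x in Set.univ ×ˢ (E ∩ Set.Icc a b), ‖f x.1‖ₑ
            ∂(ENNReal.ofReal C • (marg1 μ).prod volume) :=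
          lintegral_mono' (Measure.restrict_mono_measure hμle _) le_rfl
      _ = ENNReal.ofReal C * ((∫⁻ t, ‖f t‖ₑ ∂marg1 μ) * volume (E ∩ Set.Icc a b)) := by
          rw [Measure.restrict_smul, lintegral_smul_measure, ← Measure.prod_restrict,
            Measure.restrict_univ]
          have := lintegral_prod_mul (ν := volume.restrict (E ∩ Set.Icc a b))
            hf.1.enorm (aemeasurable_const (b := (1 : ℝ≥0∞)))
          simp only [mul_one, lintegral_one, Measure.restrict_apply_univ] at this
          rw [this, smul_eq_mul]
      _ ≤ ENNReal.ofReal C * ((∫⁻ t, ‖f t‖ₑ ∂marg1 μ) *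
            ((ENNReal.ofReal (q t₀))⁻¹ * μ (Prod.snd ⁻¹' E))) := by gcongr
      _ = _ := by
          rw [ENNReal.ofReal_div_of_pos hδ, div_eq_mul_inv]
          ring
  have hfin : ENNReal.ofReal (C / q t₀) * eLpNorm f 1 (marg1 μ) ≠ ∞ :=
    ENNReal.mul_ne_top ENNReal.ofReal_ne_top (memLp_one_iff_integrable.2 hf).eLpNorm_ne_top
  rw [← ENNReal.ofReal_toReal hfin]
  refine eLpNorm_top_condExp_le_of_setIntegral_norm_le measurable_snd.comap_le ?_
  rintro _ ⟨E, hE, rfl⟩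
  have hfst : AEStronglyMeasurable (fun x : ℝ × ℝ => f x.1) μ :=
    hf.1.comp_aemeasurable measurable_fst.aemeasurable
  rw [integral_norm_eq_lintegral_enorm hfst.restrict, Measure.real, ← ENNReal.toReal_mul]
  refine ENNReal.toReal_mono (ENNReal.mul_ne_top hfin (measure_ne_top μ _)) ?_
  rw [eLpNorm_one_eq_lintegral_enorm]
  exact hbound E hE

end
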